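/- For each fixed n ∈ ℕ, the map (ρ_α, ρ_β) ↦ 𝒲_n(ρ_α,ρ_β) is continuous on [0,∞) × [0,∞). -/

import Mathlib

/-- The weighted sup `sup_{x ∈ [-1,1]} (1-x)^ρα (1+x)^ρβ |P(x)|`. -/
noncomputable def jacobiSup (ρa ρb : ℝ) (P : Polynomial ℝ) : ℝ :=
  sSup ((fun x : ℝ => (1 - x) ^ ρa * (1 + x) ^ ρb * |P.eval x|) '' Set.Icc (-1 : ℝ) 1)

/-- The Widom factor `𝒲_n(ρα, ρβ)` for the Jacobi weight `(1-x)^ρα (1+x)^ρβ` on `[-1,1]`. -/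
noncomputable def widomFactor (ρa ρb : ℝ) (n : ℕ) : ℝ :=
  2 ^ n * sInf (jacobiSup ρa ρb '' {P : Polynomial ℝ | P.Monic ∧ P.natDegree = n})

open Filter Topology Polynomial

theorem jacobiSup_bddAbove {a b : ℝ} (ha : 0 ≤ a) (hb : 0 ≤ b) (P : ℝ[X]) :
    BddAbove ((fun x : ℝ => (1 - x) ^ a * (1 + x) ^ b * |P.eval x|) '' Set.Icc (-1 : ℝ) 1) := by
  refine isCompact_Icc.bddAbove_image (Continuous.continuousOn ?_)
  have h1 : Continuous fun x : ℝ => (1 - x) ^ a :=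
    (continuous_const.sub continuous_id).rpow_const fun _ => Or.inr ha
  have h2 : Continuous fun x : ℝ => (1 + x) ^ b :=
    (continuous_const.add continuous_id).rpow_const fun _ => Or.inr hb
  exact (h1.mul h2).mul P.continuous.abs

theorem le_jacobiSup {a b : ℝ} (ha : 0 ≤ a) (hb : 0 ≤ b) (P : ℝ[X]) {x : ℝ}
    (hx : x ∈ Set.Icc (-1 : ℝ) 1) :
    (1 - x) ^ a * (1 + x) ^ b * |P.eval x| ≤ jacobiSup a b P :=
  le_csSup (jacobiSup_bddAbove ha hb P) ⟨x, hx, rfl⟩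

theorem jacobiSup_nonneg (a b : ℝ) (P : ℝ[X]) : 0 ≤ jacobiSup a b P := by
  refine Real.sSup_nonneg ?_
  rintro _ ⟨x, hx, rfl⟩
  have h1 : 0 ≤ 1 - x := by linarith [hx.2]
  have h2 : 0 ≤ 1 + x := by linarith [hx.1]
  positivity

theorem rpow_le_rpow_abs_of_inv_le {v K d : ℝ} (hv : 0 < v) (h1 : v ≤ K) (h2 : v⁻¹ ≤ K) :
    v ^ d ≤ K ^ |d| := by
  rcases le_total 0 d with hd | hd
  · rw [abs_of_nonneg hd]
    exact Real.rpow_le_rpow hv.le h1 hd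
  · rw [abs_of_nonpos hd, ← neg_neg d, Real.rpow_neg hv.le, ← Real.inv_rpow hv.le, neg_neg]
    exact Real.rpow_le_rpow (inv_nonneg.2 hv.le) h2 (neg_nonneg.2 hd)

theorem rpow_le_mul_rpow_of_mul_le {s u v a a' : ℝ} (hs0 : 0 < s) (hs1 : s < 1) (hu : 0 ≤ u)
    (huv : s * u ≤ v) (hv : 1 - s ≤ v) (hv2 : v ≤ 2) (ha : 0 ≤ a) :
    u ^ a ≤ s⁻¹ ^ a * (2 / (1 - s)) ^ |a - a'| * v ^ a' := by
  have hs : 0 < 1 - s := sub_pos.2 hs1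
  have hv0 : 0 < v := hs.trans_le hv
  have hK : v ^ (a - a') ≤ (2 / (1 - s)) ^ |a - a'| := by
    refine rpow_le_rpow_abs_of_inv_le hv0 ?_ ?_
    · rw [le_div_iff₀ hs]
      nlinarith
    · refine (inv_anti₀ hs hv).trans ?_
      rw [inv_eq_one_div]
      gcongr
      norm_num
  calc u ^ a ≤ (s⁻¹ * v) ^ a := by
        refine Real.rpow_le_rpow hu ?_ ha
        rwa [le_inv_mul_iff₀ hs0]
    _ = s⁻¹ ^ a * (v ^ (a - a') * v ^ a') := by
        rw [Real.mul_rpow (by positivity) hv0.le, ← Real.rpow_add hv0, sub_add_cancel]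
    _ ≤ s⁻¹ ^ a * ((2 / (1 - s)) ^ |a - a'| * v ^ a') := by gcongr
    _ = _ := by ring

/-- The constant in the comparison of Widom factors obtained from dilating polynomials by `s`. -/
noncomputable def dilationConst (n : ℕ) (s : ℝ) (p q : ℝ × ℝ) : ℝ :=
  s⁻¹ ^ n * (s⁻¹ ^ p.1 * (2 / (1 - s)) ^ |p.1 - q.1|) *
    (s⁻¹ ^ p.2 * (2 / (1 - s)) ^ |p.2 - q.2|)

theorem dilationConst_pos (n : ℕ) {s : ℝ} (hs0 : 0 < s) (hs1 : s < 1) (p q : ℝ × ℝ) :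
    0 < dilationConst n s p q := by
  have hs : 0 < 1 - s := sub_pos.2 hs1
  unfold dilationConst
  positivity

theorem jacobiSup_scaleRoots_le {s : ℝ} (hs0 : 0 < s) (hs1 : s < 1) {p q : ℝ × ℝ}
    (hp : p ∈ Set.Ici (0 : ℝ) ×ˢ Set.Ici (0 : ℝ)) (hq : q ∈ Set.Ici (0 : ℝ) ×ˢ Set.Ici (0 : ℝ))
    (P : ℝ[X]) :
    jacobiSup p.1 p.2 (P.scaleRoots s⁻¹) ≤
      dilationConst P.natDegree s p q * jacobiSup q.1 q.2 P := by
  have hs : 0 < 1 - s := sub_pos.2 hs1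
  refine csSup_le ((Set.nonempty_Icc.2 (by norm_num)).image _) ?_
  rintro _ ⟨x, hx, rfl⟩
  have h1 : 0 ≤ 1 - x := by linarith [hx.2]
  have h2 : 0 ≤ 1 + x := by linarith [hx.1]
  have hl : -s ≤ s * x := by nlinarith
  have hr : s * x ≤ s := by nlinarith
  have hsx : s * x ∈ Set.Icc (-1 : ℝ) 1 := ⟨by linarith, by linarith⟩
  have e : (P.scaleRoots s⁻¹).eval x = s⁻¹ ^ P.natDegree * P.eval (s * x) := by
    have := scaleRoots_eval₂_mul (p := P) (RingHom.id ℝ) (s * x) s⁻¹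
    simpa [eval₂_id, inv_mul_cancel_left₀ hs0.ne'] using this
  have hA := rpow_le_mul_rpow_of_mul_le (a' := q.1) hs0 hs1 h1 (v := 1 - s * x)
    (by linarith) (by linarith) (by linarith) hp.1
  have hB := rpow_le_mul_rpow_of_mul_le (a' := q.2) hs0 hs1 h2 (v := 1 + s * x)
    (by linarith) (by linarith) (by linarith) hp.2
  have hv2 : 0 ≤ 1 + s * x := by linarith
  have hv1 : 0 ≤ 1 - s * x := by linarith
  have hS := le_jacobiSup hq.1 hq.2 P hsx
  have hC := (dilationConst_pos P.natDegree hs0 hs1 p q).le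
  refine le_trans ?_ (mul_le_mul_of_nonneg_left hS hC)
  simp only [e, abs_mul, abs_of_pos (pow_pos (inv_pos.2 hs0) P.natDegree)]
  refine (mul_le_mul_of_nonneg_right (mul_le_mul hA hB (by positivity) (by positivity))
    (by positivity)).trans_eq ?_
  unfold dilationConst
  ring

theorem widomFactor_le_dilationConst_mul (n : ℕ) {s : ℝ} (hs0 : 0 < s) (hs1 : s < 1)
    {p q : ℝ × ℝ} (hp : p ∈ Set.Ici (0 : ℝ) ×ˢ Set.Ici (0 : ℝ))
    (hq : q ∈ Set.Ici (0 : ℝ) ×ˢ Set.Ici (0 : ℝ)) :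
    widomFactor p.1 p.2 n ≤ dilationConst n s p q * widomFactor q.1 q.2 n := by
  have hC := dilationConst_pos n hs0 hs1 p q
  unfold widomFactor
  rw [mul_left_comm]
  refine mul_le_mul_of_nonneg_left ?_ (by positivity)
  rw [← div_le_iff₀' hC]
  refine le_csInf (Set.Nonempty.image _ ⟨X ^ n, monic_X_pow n, natDegree_X_pow n⟩) ?_
  rintro _ ⟨P, ⟨hP, rfl⟩, rfl⟩
  rw [div_le_iff₀' hC]
  have hbdd : BddBelow (jacobiSup p.1 p.2 '' {Q : ℝ[X] | Q.Monic ∧ Q.natDegree = P.natDegree}) := by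
    refine ⟨0, ?_⟩
    rintro _ ⟨Q, -, rfl⟩
    exact jacobiSup_nonneg _ _ Q
  exact (csInf_le hbdd ⟨P.scaleRoots s⁻¹,
    ⟨(monic_scaleRoots_iff _).2 hP, natDegree_scaleRoots P _⟩, rfl⟩).trans
    (jacobiSup_scaleRoots_le hs0 hs1 hp hq P)

theorem continuous_dilationConst_left (n : ℕ) {s : ℝ} (hs0 : 0 < s) (hs1 : s < 1) (q : ℝ × ℝ) :
    Continuous fun p => dilationConst n s p q := by
  have hs : 2 / (1 - s) ≠ 0 := (div_pos two_pos (sub_pos.2 hs1)).ne'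
  have hs' : s⁻¹ ≠ 0 := inv_ne_zero hs0.ne'
  unfold dilationConst
  fun_prop (disch := simp [hs, hs'])

theorem continuous_dilationConst_right (n : ℕ) {s : ℝ} (hs1 : s < 1) (p : ℝ × ℝ) :
    Continuous fun q => dilationConst n s p q := by
  have hs : 2 / (1 - s) ≠ 0 := (div_pos two_pos (sub_pos.2 hs1)).ne'
  unfold dilationConst
  fun_prop (disch := simp [hs])

theorem tendsto_dilationConst_self (n : ℕ) (p : ℝ × ℝ) :
    Tendsto (fun s => dilationConst n s p p) (𝓝[<] 1) (𝓝 1) := by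
  have h : ContinuousAt (fun s : ℝ => s⁻¹ ^ n * s⁻¹ ^ p.1 * s⁻¹ ^ p.2) 1 := by
    have hi : ContinuousAt (fun s : ℝ => s⁻¹) 1 := continuousAt_inv₀ one_ne_zero
    exact ((hi.pow n).mul (hi.rpow_const (by simp))).mul (hi.rpow_const (by simp))
  have h' := h.tendsto.mono_left (nhdsWithin_le_nhds (s := Set.Iio 1))
  simpa [dilationConst] using h'

theorem widomFactor_continuousOn (n : ℕ) :
    ContinuousOn (fun p : ℝ × ℝ => widomFactor p.1 p.2 n)
      (Set.Ici (0 : ℝ) ×ˢ Set.Ici (0 : ℝ)) := by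
  intro p hp
  have hev : ∀ᶠ s : ℝ in 𝓝[<] 1, 0 < s ∧ s < 1 :=
    Ioo_mem_nhdsLT zero_lt_one
  have hlim := tendsto_dilationConst_self n p
  refine tendsto_order.2 ⟨fun a ha => ?_, fun a ha => ?_⟩
  · have h1 : Tendsto (fun s => (dilationConst n s p p)⁻¹ * widomFactor p.1 p.2 n) (𝓝[<] 1)
        (𝓝 (widomFactor p.1 p.2 n)) := by
      simpa using (hlim.inv₀ one_ne_zero).mul_const (widomFactor p.1 p.2 n)
    obtain ⟨s, has, hs0, hs1⟩ := ((h1.eventually_const_lt ha).and hev).exists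
    have h2 : Continuous fun q => (dilationConst n s p q)⁻¹ * widomFactor p.1 p.2 n :=
      ((continuous_dilationConst_right n hs1 p).inv₀
        fun q => (dilationConst_pos n hs0 hs1 p q).ne').mul continuous_const
    filter_upwards [self_mem_nhdsWithin,
      nhdsWithin_le_nhds (h2.tendsto p |>.eventually_const_lt has)] with q hq haq
    refine haq.trans_le ?_
    rw [inv_mul_le_iff₀ (dilationConst_pos n hs0 hs1 p q)]
    exact widomFactor_le_dilationConst_mul n hs0 hs1 hp hq
  · have h1 : Tendsto (fun s => dilationConst n s p p * widomFactor p.1 p.2 n) (𝓝[<] 1)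
        (𝓝 (widomFactor p.1 p.2 n)) := by
      simpa using hlim.mul_const (widomFactor p.1 p.2 n)
    obtain ⟨s, has, hs0, hs1⟩ := ((h1.eventually_lt_const ha).and hev).exists
    have h2 : Continuous fun q => dilationConst n s q p * widomFactor p.1 p.2 n :=
      (continuous_dilationConst_left n hs0 hs1 p).mul continuous_const
    filter_upwards [self_mem_nhdsWithin,
      nhdsWithin_le_nhds (h2.tendsto p |>.eventually_lt_const has)] with q hq haq
    exact (widomFactor_le_dilationConst_mul n hs0 hs1 hq hp).trans_lt haq
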